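/- Let X be a Hilbert right ℍ-module. Then X admits an orthonormal basis: a family (e_i)_{i∈I} in X with ⟨e_i, e_j⟩ = 1 if i = j and 0 otherwise, whose right ℍ-linear span is dense in X. Moreover, any two orthonormal bases of X have the same cardinality. -/

import Mathlib

open scoped Classical

open MulOpposite

local notation "ℍ" => Quaternion ℝ

theorem span_range_eq_top_of_total {E α : Type*} [NormedAddCommGroup E]
    [InnerProductSpace ℝ E] {u : α → E}
    (_ : FiniteDimensional ℝ (Submodule.span ℝ (Set.range u)))
    (hu : ∀ x, (∀ i, inner ℝ (u i) x = 0) → x = 0) :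
    Submodule.span ℝ (Set.range u) = ⊤ := by
  rw [← Submodule.orthogonal_eq_bot_iff, eq_bot_iff]
  intro x hx
  exact hu x fun i => hx _ (Submodule.subset_span ⟨i, rfl⟩)

open Module in
/-- Two orthonormal families with trivial orthogonal complement have finite index types together,
and then the same cardinality. -/
theorem Orthonormal.finite_and_natCard_eq_of_total {E ι κ : Type*} [NormedAddCommGroup E]
    [InnerProductSpace ℝ E] {v : ι → E} {w : κ → E} (hv : Orthonormal ℝ v)
    (hv' : ∀ x, (∀ i, inner ℝ (v i) x = 0) → x = 0) (hw : Orthonormal ℝ w)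
    (hw' : ∀ x, (∀ j, inner ℝ (w j) x = 0) → x = 0) [Finite ι] :
    Finite κ ∧ Nat.card ι = Nat.card κ := by
  have hvtop := span_range_eq_top_of_total (FiniteDimensional.span_of_finite ℝ (Set.finite_range v)) hv'
  let b := Basis.mk hv.linearIndependent hvtop.ge
  have : FiniteDimensional ℝ E := b.finiteDimensional_of_finite
  have hκ : Finite κ := hw.linearIndependent.finite
  refine ⟨hκ, ?_⟩
  have hwtop := span_range_eq_top_of_total inferInstance hw'
  let c := Basis.mk hw.linearIndependent hwtop.ge
  rw [← finrank_eq_nat_card_basis b, ← finrank_eq_nat_card_basis c]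

theorem Infinite.nonempty_prod_equiv {ι : Type*} {α : Type} [Infinite ι] [Countable α]
    [Nonempty α] : Nonempty (ι × α ≃ ι) := by
  rw [← Cardinal.eq, Cardinal.mk_prod, Cardinal.lift_uzero]
  refine Cardinal.mul_eq_left (Cardinal.aleph0_le_mk ι) ?_ ?_
  · exact (Cardinal.lift_le_aleph0.2 Cardinal.mk_le_aleph0).trans (Cardinal.aleph0_le_mk ι)
  · simp

/-- An orthonormal family is no larger than any infinite family with trivial orthogonal
complement. -/
theorem Orthonormal.nonempty_embedding_of_total {E ι κ : Type*} [NormedAddCommGroup E]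
    [InnerProductSpace ℝ E] {v : ι → E} {w : κ → E}
    (hv' : ∀ x, (∀ i, inner ℝ (v i) x = 0) → x = 0) (hw : Orthonormal ℝ w) [Infinite ι] :
    Nonempty (κ ↪ ι) := by
  have hex : ∀ j, ∃ i, inner ℝ (w j) (v i) ≠ 0 := by
    intro j
    by_contra! h
    exact hw.ne_zero j (hv' _ fun i => by rw [real_inner_comm, h i])
  choose f hf using hex
  have hc : ∀ i, Countable {j | inner ℝ (w j) (v i) ≠ 0} := by
    intro i
    have := (hw.inner_products_summable (v i)).countable_support
    refine (this.mono ?_).to_subtype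
    intro j hj
    simpa using hj
  choose g hg using fun i => (hc i).exists_injective_nat
  obtain ⟨e⟩ := Infinite.nonempty_prod_equiv (ι := ι) (α := ℕ)
  refine ⟨⟨fun j => e (f j, g (f j) ⟨j, hf j⟩), fun j k hjk => ?_⟩⟩
  have h := e.injective hjk
  rw [Prod.mk.injEq] at h
  obtain ⟨h₁, h₂⟩ := h
  have key : ∀ i (hi : f k = i) (hj : inner ℝ (w j) (v i) ≠ 0),
      g i ⟨j, hj⟩ = g (f k) ⟨k, hf k⟩ → j = k := by
    rintro _ rfl hj h
    exact congrArg Subtype.val (hg _ h)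
  exact key (f j) h₁.symm (hf j) h₂

/-- Any two orthonormal families with trivial orthogonal complement are equinumerous. -/
theorem Orthonormal.nonempty_equiv_of_total {E ι κ : Type*} [NormedAddCommGroup E]
    [InnerProductSpace ℝ E] {v : ι → E} {w : κ → E} (hv : Orthonormal ℝ v)
    (hv' : ∀ x, (∀ i, inner ℝ (v i) x = 0) → x = 0) (hw : Orthonormal ℝ w)
    (hw' : ∀ x, (∀ j, inner ℝ (w j) x = 0) → x = 0) : Nonempty (ι ≃ κ) := by
  rcases finite_or_infinite ι with hι | hι
  · obtain ⟨_, h⟩ := hv.finite_and_natCard_eq_of_total hv' hw hw'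
    exact Finite.card_eq.1 h
  rcases finite_or_infinite κ with hκ | hκ
  · obtain ⟨_, h⟩ := hw.finite_and_natCard_eq_of_total hw' hv hv'
    exact Finite.card_eq.1 h.symm
  obtain ⟨f⟩ := Orthonormal.nonempty_embedding_of_total hv' hw
  obtain ⟨g⟩ := Orthonormal.nonempty_embedding_of_total hw' hv
  exact g.antisymm f

theorem nonempty_equiv_of_prod_fin_equiv {ι κ : Type*} {n : ℕ} [NeZero n]
    (e : ι × Fin n ≃ κ × Fin n) : Nonempty (ι ≃ κ) := by
  rcases finite_or_infinite ι with hι | hι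
  · have : Finite (κ × Fin n) := .of_equiv _ e
    have : Finite κ := Finite.of_injective (fun k : κ => (k, (0 : Fin n)))
      fun _ _ h => congrArg Prod.fst h
    have h := Nat.card_congr e
    simp only [Nat.card_prod, Nat.card_fin] at h
    exact Finite.card_eq.1 (Nat.eq_of_mul_eq_mul_right (NeZero.pos n) h)
  · have : Infinite κ := by
      by_contra hκ
      rw [not_infinite_iff_finite] at hκ
      exact (Finite.of_equiv _ e.symm).false
    obtain ⟨f⟩ := Infinite.nonempty_prod_equiv (ι := ι) (α := Fin n)
    obtain ⟨g⟩ := Infinite.nonempty_prod_equiv (ι := κ) (α := Fin n)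
    exact ⟨f.symm.trans (e.trans g)⟩

/-- An `ℍ`-valued inner product on a right `ℍ`-module inducing the given norm. -/
structure IsQuaternionInner {X : Type*} [NormedAddCommGroup X] [Module ℍᵐᵒᵖ X]
    (inn : X → X → ℍ) : Prop where
  add_left : ∀ x y z : X, inn (x + y) z = inn x z + inn y z
  add_right : ∀ x y z : X, inn x (y + z) = inn x y + inn x z
  smul_right : ∀ (x y : X) (β : ℍ), inn x (op β • y) = inn x y * β
  star_inn : ∀ x y : X, inn y x = star (inn x y)
  pos : ∀ x : X, ∃ r : ℝ, 0 ≤ r ∧ inn x x = (r : ℍ)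
  norm_eq : ∀ x : X, ‖x‖ = Real.sqrt ‖inn x x‖

namespace IsQuaternionInner

variable {X : Type*} [NormedAddCommGroup X] [Module ℍᵐᵒᵖ X] {inn : X → X → ℍ}

theorem smul_left (h : IsQuaternionInner inn) (x y : X) (β : ℍ) :
    inn (op β • x) y = star β * inn x y := by
  rw [h.star_inn y, h.smul_right, star_mul, ← h.star_inn]

theorem inn_self (h : IsQuaternionInner inn) (x : X) : inn x x = ((‖x‖ ^ 2 : ℝ) : ℍ) := by
  obtain ⟨r, hr, hx⟩ := h.pos x
  rw [h.norm_eq, Real.sq_sqrt (norm_nonneg _), hx, Quaternion.norm_coe, Real.norm_of_nonneg hr]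

theorem zero_right (h : IsQuaternionInner inn) (x : X) : inn x 0 = 0 := by
  simpa using h.smul_right x 0 0

theorem norm_op_smul (h : IsQuaternionInner inn) (x : X) (β : ℍ) : ‖op β • x‖ = ‖x‖ * ‖β‖ := by
  rw [h.norm_eq, h.smul_right, h.smul_left, norm_mul, norm_mul, norm_star, h.inn_self,
    Quaternion.norm_coe, norm_pow, norm_norm]
  rw [show ‖β‖ * ‖x‖ ^ 2 * ‖β‖ = (‖x‖ * ‖β‖) ^ 2 by ring, Real.sqrt_sq (by positivity)]

/-- The real inner product space underlying a right `ℍ`-module with an `ℍ`-valued inner product;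
the real inner product is the real part. -/
@[reducible] noncomputable def toReal (h : IsQuaternionInner inn) : InnerProductSpace ℝ X :=
  letI : Module ℝ X := Module.compHom X (algebraMap ℝ ℍᵐᵒᵖ)
  have smul_def (r : ℝ) (x : X) : r • x = op (r : ℍ) • x := rfl
  { norm_smul_le r x := by
      rw [smul_def, h.norm_op_smul, Quaternion.norm_coe, mul_comm]
    inner x y := (inn x y).re
    norm_sq_eq_re_inner x := by
      rw [h.inn_self, Quaternion.re_coe]; rfl
    conj_inner_symm x y := by
      simp [h.star_inn x y]
    add_left x y z := by simp [h.add_left]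
    smul_left x y r := by
      rw [smul_def, h.smul_left]
      simp }

theorem real_inner_def (h : IsQuaternionInner inn) (x y : X) :
    letI := h.toReal
    inner ℝ x y = (inn x y).re := rfl

theorem inn_eq_zero_of_forall_re (h : IsQuaternionInner inn) {x y : X}
    (hxy : ∀ β : ℍ, (inn (op β • x) y).re = 0) : inn x y = 0 := by
  have := hxy (inn x y)
  rwa [h.smul_left, Quaternion.star_mul_self, Quaternion.re_coe,
    Quaternion.normSq_eq_zero] at this

theorem inn_eq_zero_of_mem_span (h : IsQuaternionInner inn) {s : Set X} {x : X}
    (hs : ∀ y ∈ s, inn y x = 0) {y : X} (hy : y ∈ Submodule.span ℍᵐᵒᵖ s) : inn y x = 0 := by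
  induction hy using Submodule.span_induction with
  | mem y hy => exact hs y hy
  | zero => rw [h.star_inn x, h.zero_right, star_zero]
  | add y z _ _ hy hz => rw [h.add_left, hy, hz, add_zero]
  | smul a y _ hy =>
    have := h.smul_left y x a.unop
    rwa [hy, mul_zero, op_unop] at this

theorem eq_zero_of_dense_span (h : IsQuaternionInner inn) {s : Set X}
    (hs : Dense (Submodule.span ℍᵐᵒᵖ s : Set X)) {x : X} (hx : ∀ y ∈ s, inn y x = 0) :
    x = 0 := by
  let := h.toReal
  refine hs.eq_zero_of_inner_right (𝕜 := ℝ) fun y hy => ?_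
  rw [h.real_inner_def, h.inn_eq_zero_of_mem_span hx hy, Quaternion.re_zero]

/-- A right `ℍ`-submodule with trivial orthogonal complement is dense. -/
theorem dense_of_forall_inn_eq_zero [CompleteSpace X] (h : IsQuaternionInner inn)
    (K : Submodule ℍᵐᵒᵖ X) (hK : ∀ x, (∀ y ∈ K, inn y x = 0) → x = 0) : Dense (K : Set X) := by
  let := h.toReal
  let K' : Submodule ℝ X :=
    { K with smul_mem' := fun r _ hx => K.smul_mem (op (r : ℍ)) hx }
  have : K'.topologicalClosure = ⊤ := by
    rw [Submodule.topologicalClosure_eq_top_iff, eq_bot_iff]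
    intro x hx
    refine hK x fun y hy => h.inn_eq_zero_of_forall_re fun β => ?_
    exact hx (op β • y) (K.smul_mem _ hy)
  exact (Submodule.dense_iff_topologicalClosure_eq_top (s := K')).2 this

/-- The standard real basis `1, i, j, k` of the quaternions. -/
def unit : Fin 4 → ℍ := ![⟨1, 0, 0, 0⟩, ⟨0, 1, 0, 0⟩, ⟨0, 0, 1, 0⟩, ⟨0, 0, 0, 1⟩]

theorem _root_.Quaternion.re_star_mul (p q : ℍ) :
    (star p * q).re = p.re * q.re + p.imI * q.imI + p.imJ * q.imJ + p.imK * q.imK := by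
  rw [Quaternion.re_mul, Quaternion.re_star, Quaternion.imI_star, Quaternion.imJ_star,
    Quaternion.imK_star]
  ring

theorem re_star_unit_mul_unit (a b : Fin 4) :
    (star (unit a) * unit b).re = if a = b then 1 else 0 := by
  rw [Quaternion.re_star_mul]
  fin_cases a <;> fin_cases b <;> simp [unit]

theorem eq_zero_of_forall_re_star_unit_mul {q : ℍ}
    (hq : ∀ a, (star (unit a) * q).re = 0) : q = 0 := by
  simp only [Quaternion.re_star_mul, Fin.forall_fin_succ] at hq
  simp [unit] at hq
  obtain ⟨h₀, h₁, h₂, h₃⟩ := hq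
  exact Quaternion.ext _ _ h₀ h₁ h₂ h₃

theorem orthonormal_unit (h : IsQuaternionInner inn) {I : Type*} {e : I → X}
    (he : ∀ i j, inn (e i) (e j) = if i = j then 1 else 0) :
    letI := h.toReal
    Orthonormal ℝ fun p : I × Fin 4 => op (unit p.2) • e p.1 := by
  let := h.toReal
  rw [orthonormal_iff_ite]
  rintro ⟨i, a⟩ ⟨j, b⟩
  rw [h.real_inner_def, h.smul_right, h.smul_left, he]
  by_cases hij : i = j
  · simp only [hij, if_true, mul_one, re_star_unit_mul_unit, Prod.mk.injEq, true_and]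
  · rw [if_neg hij, mul_zero, zero_mul, Quaternion.re_zero,
      if_neg fun hp => hij (congrArg Prod.fst hp)]

theorem total_unit (h : IsQuaternionInner inn) {I : Type*} {e : I → X}
    (he : Dense (Submodule.span ℍᵐᵒᵖ (Set.range e) : Set X)) (x : X)
    (hx : letI := h.toReal
      ∀ p : I × Fin 4, inner ℝ (op (unit p.2) • e p.1) x = 0) : x = 0 := by
  refine h.eq_zero_of_dense_span he ?_
  rintro _ ⟨i, rfl⟩
  refine eq_zero_of_forall_re_star_unit_mul fun a => ?_
  rw [← h.smul_left]
  exact hx (i, a)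

theorem nonempty_equiv (h : IsQuaternionInner inn) {I₁ I₂ : Type*} {e₁ : I₁ → X} {e₂ : I₂ → X}
    (h₁ : ∀ i j, inn (e₁ i) (e₁ j) = if i = j then 1 else 0)
    (d₁ : Dense (Submodule.span ℍᵐᵒᵖ (Set.range e₁) : Set X))
    (h₂ : ∀ i j, inn (e₂ i) (e₂ j) = if i = j then 1 else 0)
    (d₂ : Dense (Submodule.span ℍᵐᵒᵖ (Set.range e₂) : Set X)) : Nonempty (I₁ ≃ I₂) := by
  let := h.toReal
  obtain ⟨e⟩ := (h.orthonormal_unit h₁).nonempty_equiv_of_total (h.total_unit d₁)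
    (h.orthonormal_unit h₂) (h.total_unit d₂)
  exact nonempty_equiv_of_prod_fin_equiv e

theorem exists_orthonormal_basis [CompleteSpace X] (h : IsQuaternionInner inn) :
    ∃ s : Set X, (∀ x y : s, inn x y = if x = y then 1 else 0) ∧
      Dense (Submodule.span ℍᵐᵒᵖ s : Set X) := by
  obtain ⟨s, hs⟩ := zorn_subset
    {s : Set X | ∀ x ∈ s, ∀ y ∈ s, inn x y = if x = y then 1 else 0} (by
      intro c hc hchain
      refine ⟨⋃₀ c, ?_, fun t ht => Set.subset_sUnion_of_mem ht⟩
      rintro x ⟨t, ht, hx⟩ y ⟨t', ht', hy⟩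
      rcases hchain.total ht ht' with htt | htt
      · exact hc ht' x (htt hx) y hy
      · exact hc ht x hx y (htt hy))
  refine ⟨s, fun x y => ?_, h.dense_of_forall_inn_eq_zero _ fun x hx => ?_⟩
  · rw [hs.prop x x.2 y y.2]
    simp only [Subtype.ext_iff]
  · by_contra hx0
    have hn : ‖x‖ ≠ 0 := norm_ne_zero_iff.2 hx0
    set u : X := op ((‖x‖⁻¹ : ℝ) : ℍ) • x with hu
    have huu : inn u u = 1 := by
      rw [h.inn_self, hu, h.norm_op_smul, Quaternion.norm_coe, norm_inv, norm_norm,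
        mul_inv_cancel₀ hn, one_pow, Quaternion.coe_one]
    have hsu : ∀ y ∈ s, inn y u = 0 := fun y hy => by
      rw [hu, h.smul_right, hx y (Submodule.subset_span hy), zero_mul]
    have hus : ∀ y ∈ s, inn u y = 0 := fun y hy => by
      rw [h.star_inn y, hsu y hy, star_zero]
    have hmem : u ∉ s := fun hmem => one_ne_zero (huu.symm.trans (hsu u hmem))
    refine hmem (hs.le_of_ge (y := insert u s) ?_ (Set.subset_insert u s) (Set.mem_insert u s))
    rintro y (rfl | hy) z (rfl | hz)
    · rw [huu, if_pos rfl]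
    · rw [hus z hz, if_neg]
      rintro rfl
      exact hmem hz
    · rw [hsu y hy, if_neg]
      rintro rfl
      exact hmem hy
    · exact hs.prop y hy z hz

end IsQuaternionInner

theorem stmt8.{u, v, w} (X : Type u)
    [NormedAddCommGroup X] [Module ℍᵐᵒᵖ X] [CompleteSpace X]
    (inn : X → X → ℍ)
    (h_add_l : ∀ x y z : X, inn (x + y) z = inn x z + inn y z)
    (h_add_r : ∀ x y z : X, inn x (y + z) = inn x y + inn x z)
    (h_smul : ∀ (x y : X) (β : ℍ), inn x (op β • y) = inn x y * β)
    (h_star : ∀ x y : X, inn y x = star (inn x y))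
    (h_pos : ∀ x : X, ∃ r : ℝ, 0 ≤ r ∧ inn x x = (r : ℍ))
    (h_def : ∀ x : X, inn x x = 0 → x = 0)
    (h_norm : ∀ x : X, ‖x‖ = Real.sqrt ‖inn x x‖) :
    (∃ (I : Type u) (e : I → X),
      (∀ i j, inn (e i) (e j) = if i = j then 1 else 0) ∧
      Dense (↑(Submodule.span ℍᵐᵒᵖ (Set.range e)) : Set X)) ∧
    (∀ (I₁ : Type v) (I₂ : Type w) (e₁ : I₁ → X) (e₂ : I₂ → X),
      (∀ i j, inn (e₁ i) (e₁ j) = if i = j then 1 else 0) →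
      Dense (↑(Submodule.span ℍᵐᵒᵖ (Set.range e₁)) : Set X) →
      (∀ i j, inn (e₂ i) (e₂ j) = if i = j then 1 else 0) →
      Dense (↑(Submodule.span ℍᵐᵒᵖ (Set.range e₂)) : Set X) →
      Nonempty (I₁ ≃ I₂)) := by
  have h : IsQuaternionInner inn := ⟨h_add_l, h_add_r, h_smul, h_star, h_pos, h_norm⟩
  refine ⟨?_, fun _ _ _ _ h₁ d₁ h₂ d₂ => h.nonempty_equiv h₁ d₁ h₂ d₂⟩
  obtain ⟨s, hs, hd⟩ := h.exists_orthonormal_basis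
  exact ⟨s, Subtype.val, fun x y => by convert hs x y, by rwa [Subtype.range_val]⟩
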